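/- Let x > 1 be a real number and k a positive integer. Then ∑_{n=1}^{∞} L( x^{kn}·(x^k - 1)² / (x^{k(n+1)} - 1)² ) = L( 1/x^k ). -/

import Mathlib

/-- The Rogers dilogarithm on `[0,1]`: `L(x) = Li₂(x) + (1/2)·log x · log (1-x)`
for `0 < x < 1`, with `L 0 = 0` and `L 1 = π²/6`. -/
noncomputable def rogersL (x : ℝ) : ℝ :=
  if x = 0 then 0
  else if x = 1 then Real.pi ^ 2 / 6
  else (∑' n : ℕ, x ^ (n + 1) / ((n : ℝ) + 1) ^ 2) + 1 / 2 * Real.log x * Real.log (1 - x)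

open Filter Topology in
theorem hasDerivAt_dilog_series {x : ℝ} (hx : |x| < 1) :
    HasDerivAt (fun z : ℝ => ∑' n : ℕ, z ^ (n + 1) / ((n : ℝ) + 1) ^ 2)
      (∑' n : ℕ, x ^ n / ((n : ℝ) + 1)) x := by
  obtain ⟨r, hxr, hr⟩ := exists_between hx
  have hr0 : 0 < r := (abs_nonneg x).trans_lt hxr
  refine hasDerivAt_tsum_of_isPreconnected (F := ℝ) (𝕜 := ℝ) (t := Set.Ioo (-r) r) (y₀ := 0)
    (g := fun (n : ℕ) (z : ℝ) => z ^ (n + 1) / ((n : ℝ) + 1) ^ 2)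
    (g' := fun (n : ℕ) (z : ℝ) => z ^ n / ((n : ℝ) + 1))
    (summable_geometric_of_lt_one hr0.le hr) isOpen_Ioo isPreconnected_Ioo
    (fun n y _ => ?_) (fun n y hy => ?_) ⟨by linarith, hr0⟩ ?_ (abs_lt.mp hxr)
  · have h : (n : ℝ) + 1 ≠ 0 := by positivity
    refine ((hasDerivAt_pow (n + 1) y).div_const (((n : ℝ) + 1) ^ 2)).congr_deriv ?_
    push_cast
    field_simp
  · rw [norm_div, norm_pow, Real.norm_eq_abs, Real.norm_of_nonneg (by positivity)]
    have hy' : |y| ≤ r := (abs_lt.mpr hy).le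
    calc |y| ^ n / ((n : ℝ) + 1) ≤ |y| ^ n :=
          div_le_self (by positivity) (by linarith [n.cast_nonneg (α := ℝ)])
      _ ≤ r ^ n := by gcongr
  · simp

theorem rogersL_eq {x : ℝ} (h0 : 0 < x) (h1 : x < 1) :
    rogersL x = (∑' n : ℕ, x ^ (n + 1) / ((n : ℝ) + 1) ^ 2)
      + 1 / 2 * Real.log x * Real.log (1 - x) := by
  simp [rogersL, h0.ne', h1.ne]

theorem rogersL_nonneg {x : ℝ} (h0 : 0 < x) (h1 : x < 1) : 0 ≤ rogersL x := by
  rw [rogersL_eq h0 h1]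
  have : 0 ≤ ∑' n : ℕ, x ^ (n + 1) / ((n : ℝ) + 1) ^ 2 := tsum_nonneg fun n => by positivity
  nlinarith [mul_nonneg_of_nonpos_of_nonpos (Real.log_nonpos h0.le h1.le)
    (Real.log_nonpos (sub_pos.mpr h1).le (by linarith))]

theorem hasDerivAt_rogersL {x : ℝ} (h0 : 0 < x) (h1 : x < 1) :
    HasDerivAt rogersL (-(1 / 2) * (Real.log (1 - x) / x + Real.log x / (1 - x))) x := by
  have hx1 : 1 - x ≠ 0 := by linarith
  have hx : |x| < 1 := by rwa [abs_of_pos h0]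
  have hsum : (∑' n : ℕ, x ^ n / ((n : ℝ) + 1)) = -Real.log (1 - x) / x := by
    have h := (Real.hasSum_pow_div_log_of_abs_lt_one hx).div_const x
    rw [← h.tsum_eq]
    congr 1 with n
    field_simp
    ring
  have hlog : HasDerivAt (fun z : ℝ => Real.log (1 - z)) (-1 / (1 - x)) x :=
    ((hasDerivAt_id x).const_sub 1).log hx1
  have h := (hasDerivAt_dilog_series hx).add
    (((Real.hasDerivAt_log h0.ne').const_mul (1 / 2)).mul hlog)
  rw [hsum] at h
  refine (h.congr_of_eventuallyEq ?_).congr_deriv ?_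
  · filter_upwards [Ioo_mem_nhds h0 h1] with z hz
    exact rogersL_eq hz.1 hz.2
  · field_simp
    ring

open Filter Topology in
theorem tendsto_rogersL_zero : Tendsto rogersL (𝓝[>] 0) (𝓝 0) := by
  have hs : Tendsto (fun z : ℝ => ∑' n : ℕ, z ^ (n + 1) / ((n : ℝ) + 1) ^ 2) (𝓝[>] 0) (𝓝 0) := by
    have h := (hasDerivAt_dilog_series (x := 0) (by simp)).continuousAt.tendsto
    simp only [zero_pow (Nat.succ_ne_zero _), zero_div, tsum_zero] at h
    exact h.mono_left nhdsWithin_le_nhds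
  have hlog : HasDerivAt (fun z : ℝ => Real.log (1 - z)) (-1) 0 := by
    simpa using ((hasDerivAt_id (0 : ℝ)).const_sub 1).log (by simp)
  have hslope := hlog.tendsto_slope.mono_left
    (nhdsWithin_mono 0 (fun z (hz : 0 < z) => hz.ne'))
  have hxlog : Tendsto (fun z : ℝ => z * Real.log z) (𝓝[>] 0) (𝓝 0) := by
    have h := Real.continuous_mul_log.tendsto 0
    simp only [zero_mul] at h
    exact h.mono_left nhdsWithin_le_nhds
  have h := hs.add ((hxlog.mul hslope).const_mul (1 / 2))
  simp only [zero_mul, mul_zero, add_zero] at h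
  refine h.congr' ?_
  filter_upwards [Ioo_mem_nhdsGT (zero_lt_one (α := ℝ))] with z hz
  rw [rogersL_eq hz.1 hz.2]
  have := hz.1.ne'
  simp only [slope_def_field, sub_zero, Real.log_one]
  field_simp

theorem eq_of_hasDerivAt_zero_Ioo {f : ℝ → ℝ}
    (hf : ∀ x ∈ Set.Ioo (0 : ℝ) 1, HasDerivAt f 0 x) {a b : ℝ}
    (ha : a ∈ Set.Ioo (0 : ℝ) 1) (hb : b ∈ Set.Ioo (0 : ℝ) 1) : f a = f b :=
  isOpen_Ioo.is_const_of_deriv_eq_zero isPreconnected_Ioo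
    (fun x hx => (hf x hx).differentiableAt.differentiableWithinAt)
    (fun x hx => (hf x hx).deriv) ha hb

theorem rogersL_add_rogersL_one_sub {a b : ℝ}
    (ha : a ∈ Set.Ioo (0 : ℝ) 1) (hb : b ∈ Set.Ioo (0 : ℝ) 1) :
    rogersL a + rogersL (1 - a) = rogersL b + rogersL (1 - b) := by
  refine eq_of_hasDerivAt_zero_Ioo (f := fun x => rogersL x + rogersL (1 - x))
    (fun x ⟨h0, h1⟩ => ?_) ha hb
  have h := (hasDerivAt_rogersL h0 h1).add
    (HasDerivAt.comp x (hasDerivAt_rogersL (x := 1 - x) (by linarith) (by linarith))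
      ((hasDerivAt_id x).const_sub 1))
  refine h.congr_deriv ?_
  rw [sub_sub_cancel]
  ring

open Filter Topology in
/-- Abel's five-term relation for the Rogers dilogarithm. -/
theorem rogersL_five_term {x y : ℝ} (hx : x ∈ Set.Ioo (0 : ℝ) 1) (hy : y ∈ Set.Ioo (0 : ℝ) 1) :
    rogersL x + rogersL y = rogersL (x * y) + rogersL (x * (1 - y) / (1 - x * y))
      + rogersL (y * (1 - x) / (1 - x * y)) := by
  obtain ⟨hy0, hy1⟩ := hy
  have hy' : 0 < 1 - y := by linarith
  set F : ℝ → ℝ := fun z => rogersL z - rogersL (z * y) - rogersL (z * (1 - y) / (1 - z * y))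
      - rogersL (y * (1 - z) / (1 - z * y)) with hF
  have hderiv : ∀ z ∈ Set.Ioo (0 : ℝ) 1, HasDerivAt F 0 z := by
    rintro z ⟨h0, h1⟩
    have hz' : 0 < 1 - z := by linarith
    have hzy : 0 < z * y := mul_pos h0 hy0
    have hzy1 : 0 < 1 - z * y := by nlinarith
    have e1 : 1 - z * (1 - y) / (1 - z * y) = (1 - z) / (1 - z * y) := by
      field_simp; ring
    have e2 : 1 - y * (1 - z) / (1 - z * y) = (1 - y) / (1 - z * y) := by
      rw [eq_div_iff hzy1.ne', sub_mul, div_mul_cancel₀ _ hzy1.ne']; ring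
    have d0 : HasDerivAt (fun w : ℝ => w * y) y z := by
      simpa using (hasDerivAt_id z).mul_const y
    have dD : HasDerivAt (fun w : ℝ => 1 - w * y) (-y) z := d0.const_sub 1
    have d1 : HasDerivAt (fun w : ℝ => w * (1 - y) / (1 - w * y))
        ((1 - y) / (1 - z * y) ^ 2) z := by
      refine (((hasDerivAt_id z).mul_const (1 - y)).div dD hzy1.ne').congr_deriv ?_
      simp only [id]
      congr 1
      ring
    have d2 : HasDerivAt (fun w : ℝ => y * (1 - w) / (1 - w * y))
        (-(y * (1 - y)) / (1 - z * y) ^ 2) z := by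
      refine ((((hasDerivAt_id z).const_sub 1).const_mul y).div dD hzy1.ne').congr_deriv ?_
      simp only [id]
      congr 1
      ring
    have p1 : 0 < z * (1 - y) / (1 - z * y) := by positivity
    have p2 : 0 < y * (1 - z) / (1 - z * y) := by positivity
    have q1 : 0 < (1 - z) / (1 - z * y) := by positivity
    have q2 : 0 < (1 - y) / (1 - z * y) := by positivity
    have h := (((hasDerivAt_rogersL h0 h1).sub
      (HasDerivAt.comp z (hasDerivAt_rogersL hzy (by linarith)) d0)).sub
      (HasDerivAt.comp z (hasDerivAt_rogersL p1 (by linarith)) d1)).sub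
      (HasDerivAt.comp z (hasDerivAt_rogersL p2 (by linarith)) d2)
    refine h.congr_deriv ?_
    rw [e1, e2, Real.log_div (by positivity) hzy1.ne', Real.log_div (by positivity) hzy1.ne',
      Real.log_div (by positivity) hzy1.ne', Real.log_div (by positivity) hzy1.ne',
      Real.log_mul h0.ne' hy'.ne', Real.log_mul hy0.ne' hz'.ne', Real.log_mul h0.ne' hy0.ne']
    generalize Real.log (1 - z * y) = e
    generalize Real.log (1 - z) = b
    generalize Real.log (1 - y) = d
    generalize Real.log z = a
    generalize Real.log y = c
    field_simp
    ring
  have hlim : Tendsto F (𝓝[>] 0) (𝓝 (-rogersL y)) := by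
    have hmem : ∀ᶠ z : ℝ in 𝓝[>] 0, z ∈ Set.Ioo (0 : ℝ) 1 := Ioo_mem_nhdsGT zero_lt_one
    have t1 : Tendsto (fun z : ℝ => z * y) (𝓝[>] 0) (𝓝[>] 0) := by
      refine tendsto_nhdsWithin_iff.mpr ⟨?_, ?_⟩
      · have : ContinuousAt (fun z : ℝ => z * y) 0 := by fun_prop
        simpa using this.tendsto.mono_left (nhdsWithin_le_nhds (s := Set.Ioi 0))
      · filter_upwards [hmem] with z hz
        exact mul_pos hz.1 hy0
    have t2 : Tendsto (fun z : ℝ => z * (1 - y) / (1 - z * y)) (𝓝[>] 0) (𝓝[>] 0) := by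
      refine tendsto_nhdsWithin_iff.mpr ⟨?_, ?_⟩
      · have : ContinuousAt (fun z : ℝ => z * (1 - y) / (1 - z * y)) 0 := by
          refine ContinuousAt.div (by fun_prop) (by fun_prop) (by simp)
        simpa using this.tendsto.mono_left (nhdsWithin_le_nhds (s := Set.Ioi 0))
      · filter_upwards [hmem] with z hz
        have : 0 < 1 - z * y := by nlinarith [hz.1, hz.2]
        exact div_pos (mul_pos hz.1 hy') this
    have t3 : Tendsto (fun z : ℝ => y * (1 - z) / (1 - z * y)) (𝓝[>] 0) (𝓝 y) := by
      have : ContinuousAt (fun z : ℝ => y * (1 - z) / (1 - z * y)) 0 := by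
        refine ContinuousAt.div (by fun_prop) (by fun_prop) (by simp)
      simpa using this.tendsto.mono_left (nhdsWithin_le_nhds (s := Set.Ioi 0))
    have h := ((tendsto_rogersL_zero.sub (tendsto_rogersL_zero.comp t1)).sub
      (tendsto_rogersL_zero.comp t2)).sub
      ((hasDerivAt_rogersL hy0 hy1).continuousAt.tendsto.comp t3)
    simpa using h
  have hconst : Tendsto F (𝓝[>] 0) (𝓝 (F x)) := by
    refine tendsto_const_nhds.congr' ?_
    filter_upwards [Ioo_mem_nhdsGT (zero_lt_one (α := ℝ))] with z hz
    exact eq_of_hasDerivAt_zero_Ioo hderiv hx hz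
  have := tendsto_nhds_unique hconst hlim
  simp only [hF] at this
  linarith

open Filter Topology in
theorem hasSum_rogersL_of_mem_Ioo {q : ℝ} (hq : q ∈ Set.Ioo (0 : ℝ) 1) :
    HasSum (fun n : ℕ => rogersL (q ^ (n + 1) * (1 - q) ^ 2 / (1 - q ^ (n + 2)) ^ 2))
      (rogersL q) := by
  obtain ⟨h0, h1⟩ := hq
  have hq' : 0 < 1 - q := by linarith
  have hpow : ∀ n : ℕ, 0 < 1 - q ^ (n + 1) := fun n =>
    sub_pos.mpr (pow_lt_one₀ h0.le h1 n.succ_ne_zero)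
  set v : ℕ → ℝ := fun n => q ^ (n + 1) * (1 - q) / (1 - q ^ (n + 2)) with hv
  set w : ℕ → ℝ := fun n => (1 - q) / (1 - q ^ (n + 2)) with hw
  have hv' : ∀ n, 1 - v n = (1 - q ^ (n + 1)) / (1 - q ^ (n + 2)) := fun n => by
    have := (hpow (n + 1)).ne'
    simp only [hv]
    field_simp
    ring
  have hw' : ∀ n, 1 - w n = q * (1 - q ^ (n + 1)) / (1 - q ^ (n + 2)) := fun n => by
    have := (hpow (n + 1)).ne'
    simp only [hw]
    field_simp
    ring
  have hvmem : ∀ n, v n ∈ Set.Ioo (0 : ℝ) 1 := fun n => by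
    have a := hpow n
    have b : 0 < 1 - q ^ (n + 2) := hpow (n + 1)
    refine ⟨by simp only [hv]; positivity, sub_pos.mp ?_⟩
    rw [hv' n]
    positivity
  have hwmem : ∀ n, w n ∈ Set.Ioo (0 : ℝ) 1 := fun n => by
    have a := hpow n
    have b : 0 < 1 - q ^ (n + 2) := hpow (n + 1)
    refine ⟨by simp only [hw]; positivity, sub_pos.mp ?_⟩
    rw [hw' n]
    positivity
  have hprod : ∀ n, q ^ (n + 1) * (1 - q) ^ 2 / (1 - q ^ (n + 2)) ^ 2 = v n * w n := fun n => by
    simp only [hv, hw]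
    rw [div_mul_div_comm]
    ring
  have hone : ∀ n, 1 - v n * w n
      = (1 - q ^ (n + 1)) * (1 - q ^ (n + 3)) / (1 - q ^ (n + 2)) ^ 2 := fun n => by
    have b : 1 - q ^ (n + 2) ≠ 0 := (hpow (n + 1)).ne'
    rw [← hprod n]
    field_simp
    ring
  have hstep : ∀ n, rogersL (v n * w n)
      = (rogersL (v n) + rogersL (w n)) - (rogersL (v (n + 1)) + rogersL (w (n + 1))) := by
    intro n
    have a := (hpow n).ne'
    have b : 1 - q ^ (n + 2) ≠ 0 := (hpow (n + 1)).ne'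
    have c : 1 - q ^ (n + 3) ≠ 0 := (hpow (n + 2)).ne'
    have h := rogersL_five_term (hvmem n) (hwmem n)
    have e1 : v n * (1 - w n) / (1 - v n * w n) = v (n + 1) := by
      rw [hone, hw']
      simp only [hv]
      rw [show n + 1 + 2 = n + 3 from rfl]
      field_simp
      ring
    have e2 : w n * (1 - v n) / (1 - v n * w n) = w (n + 1) := by
      rw [hone, hv']
      simp only [hw]
      rw [show n + 1 + 2 = n + 3 from rfl]
      field_simp
    rw [e1, e2] at h
    linarith
  have hinit : rogersL (v 0) + rogersL (w 0) = rogersL q + rogersL (1 - q) := by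
    have : w 0 = 1 - v 0 := by
      rw [hv']
      simp [hw]
    rw [this]
    exact rogersL_add_rogersL_one_sub (hvmem 0) ⟨h0, h1⟩
  have hpow0 : ∀ m : ℕ, Tendsto (fun n : ℕ => q ^ (n + m)) atTop (𝓝 0) := fun m =>
    (tendsto_pow_atTop_nhds_zero_of_lt_one h0.le h1).comp (tendsto_add_atTop_nat m)
  have hden : Tendsto (fun n : ℕ => 1 - q ^ (n + 2)) atTop (𝓝 1) := by
    simpa using (hpow0 2).const_sub 1
  have hvlim : Tendsto v atTop (𝓝[>] 0) := by
    refine tendsto_nhdsWithin_iff.mpr ⟨?_, Eventually.of_forall fun n => (hvmem n).1⟩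
    have h := ((hpow0 1).mul_const (1 - q)).div hden one_ne_zero
    rwa [zero_mul, zero_div] at h
  have hwlim : Tendsto w atTop (𝓝 (1 - q)) := by
    have h := (tendsto_const_nhds (x := 1 - q)).div hden one_ne_zero
    rwa [div_one] at h
  have hlim := (tendsto_rogersL_zero.comp hvlim).add
    ((hasDerivAt_rogersL hq' (by linarith)).continuousAt.tendsto.comp hwlim)
  simp only [hprod]
  rw [hasSum_iff_tendsto_nat_of_nonneg fun n => rogersL_nonneg
    (mul_pos (hvmem n).1 (hwmem n).1)
    (mul_lt_one_of_nonneg_of_lt_one_left (hvmem n).1.le (hvmem n).2 (hwmem n).2.le)]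
  have hsum : ∀ N : ℕ, ∑ n ∈ Finset.range N, rogersL (v n * w n)
      = (rogersL q + rogersL (1 - q)) - (rogersL (v N) + rogersL (w N)) := fun N => by
    rw [Finset.sum_congr rfl fun n _ => hstep n,
      Finset.sum_range_sub' (fun n => rogersL (v n) + rogersL (w n)), hinit]
  simp only [hsum]
  simpa using hlim.const_sub (rogersL q + rogersL (1 - q))

theorem stmt_14 (x : ℝ) (hx : 1 < x) (k : ℕ) (hk : 0 < k) :
    ∑' n : ℕ, rogersL (x ^ (k * (n + 1)) * (x ^ k - 1) ^ 2 / (x ^ (k * (n + 2)) - 1) ^ 2) =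
      rogersL (1 / x ^ k) := by
  have hy : 1 < x ^ k := one_lt_pow₀ hx hk.ne'
  simp only [pow_mul]
  generalize x ^ k = y at hy ⊢
  have hy0 : 0 < y := by linarith
  rw [← (hasSum_rogersL_of_mem_Ioo (q := 1 / y)
    ⟨by positivity, (div_lt_one hy0).mpr hy⟩).tsum_eq]
  congr 1 with n
  congr 1
  have hn : 1 < y ^ (n + 2) := one_lt_pow₀ hy (by simp)
  have hn' : y ^ (n + 2) - 1 ≠ 0 := by linarith
  have e1 : 1 - 1 / y = (y - 1) / y := by field_simp
  have e2 : 1 - (1 / y) ^ (n + 2) = (y ^ (n + 2) - 1) / y ^ (n + 2) := by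
    rw [one_div, inv_pow]; field_simp
  rw [e1, e2, one_div, inv_pow]
  field_simp
  ring
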